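/- (Uniqueness of the generic type) Let D₀ ◁ D be an extension of K-powered fields with D₀ partial and D full, and let v ∈ D \ pcl(D₀). Then ⟨D₀, v⟩_Q ◁ D. Moreover v is a good basis for ⟨D₀, v⟩_Q over D₀, so for any other v' ∈ D \ pcl(D₀) there is an isomorphism ⟨D₀, v⟩_Q ≅ ⟨D₀, v'⟩_Q over D₀ sending v to v'. -/

import Mathlib

open Set Submodule

/-- Relative linear dimension: the dimension of the span of `A ∪ B` modulo the span of `B`. -/
noncomputable def ldim (R : Type*) [DivisionRing R] {V : Type*} [AddCommGroup V] [Module R V]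
    (A B : Set V) : ℕ :=
  Module.finrank R (↥(span R (A ∪ B)) ⧸ (span R B).comap (span R (A ∪ B)).subtype)

/-- Relative transcendence degree of `A` over (the field generated by) `B`. -/
noncomputable def td {F : Type*} [Field F] [CharZero F] (A B : Set F) : ℕ :=
  sSup {n : ℕ | ∃ s : Fin n → F, (∀ i, s i ∈ A) ∧
    AlgebraicIndependent (Algebra.adjoin ℚ B) s}

/-- A partial K-powered field: a ℚ-subspace `D` of a `K`-vector space `V` together with a
partial exponential group homomorphism into `Fˣ`, such that `D` `K`-spans `V` and
`exp(D)` generates `F` as a field. -/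
structure PPF (K : Type) [Field K] [CharZero K] where
  V : Type
  F : Type
  [addV : AddCommGroup V]
  [modK : Module K V]
  [modQ : Module ℚ V]
  [fieldF : Field F]
  [charF : CharZero F]
  D : Submodule ℚ V
  exp : V → F
  exp_ne_zero : ∀ x ∈ D, exp x ≠ 0
  exp_add : ∀ x ∈ D, ∀ y ∈ D, exp (x + y) = exp x * exp y
  spans : span K (D : Set V) = ⊤
  generates : Subfield.closure (exp '' D) = ⊤

attribute [instance] PPF.addV PPF.modK PPF.modQ PPF.fieldF PPF.charF

variable {K : Type} [Field K] [CharZero K]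

/-- The predimension δ(A/B) = ldim_K(A/B) + td(exp A / exp B) − ldim_ℚ(A/B). -/
noncomputable def PPF.delta (P : PPF K) (A B : Set P.V) : ℤ :=
  (ldim K A B : ℤ) + (td (P.exp '' A) (P.exp '' B) : ℤ) - (ldim ℚ A B : ℤ)

/-- A subset is strong in `P` if every finite tuple from the domain `D` has
nonnegative predimension over it. -/
def PPF.StrongIn (P : PPF K) (S : Set P.V) : Prop :=
  ∀ (n : ℕ) (z : Fin n → P.V), (∀ i, z i ∈ P.D) → 0 ≤ P.delta (Set.range z) S

/-- A strong extension `D₀ ◁ D₁` of sub-partial-K-powered fields of `P`: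
kernel-preserving, and every finite tuple from `D₁` has nonnegative predimension over `D₀`. -/
def PPF.StrongExt (P : PPF K) (D₀ D₁ : Submodule ℚ P.V) : Prop :=
  D₀ ≤ D₁ ∧ D₁ ≤ P.D ∧ (∀ x ∈ D₁, P.exp x = 1 → x ∈ D₀) ∧
    ∀ (n : ℕ) (z : Fin n → P.V), (∀ i, z i ∈ D₁) → 0 ≤ P.delta (Set.range z) (D₀ : Set P.V)

/-- The K-powers closure of `A` inside the sub-powered-field `E` of `P`. -/
def PPF.pclIn (P : PPF K) (E : Submodule ℚ P.V) (A : Set P.V) : Submodule ℚ P.V :=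
  sInf {S | A ⊆ S ∧ S ≤ E ∧ ∀ (n : ℕ) (z : Fin n → P.V), (∀ i, z i ∈ E) →
      P.delta (Set.range z) (S : Set P.V) ≤ 0 → ∀ i, z i ∈ S}

/-- Powers-transcendence degree of `A` over `B`, computed in the sub-powered-field `E` of `P`:
the least size of a tuple from `E` whose adjunction to `B` captures `A` in the closure. -/
noncomputable def PPF.ktdIn (P : PPF K) (E : Submodule ℚ P.V) (A B : Set P.V) : ℕ :=
  sInf {m | ∃ s : Fin m → P.V, (∀ i, s i ∈ E) ∧ A ⊆ P.pclIn E (B ∪ Set.range s)}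

/-- `S` is a purely powers-transcendental extension of `D₀` inside `P`: every finite tuple
from `S` not entirely contained in `D₀` has strictly positive predimension over `D₀`. -/
def PPF.PPT (P : PPF K) (D₀ S : Submodule ℚ P.V) : Prop :=
  D₀ ≤ S ∧ ∀ (n : ℕ) (z : Fin n → P.V), (∀ i, z i ∈ S) → (∃ i, z i ∉ D₀) →
    0 < P.delta (Set.range z) (D₀ : Set P.V)

/-- The subfield of `F` generated by the exponentials of `S`. -/
def PPF.fieldOf (P : PPF K) (S : Submodule ℚ P.V) : Subfield P.F :=
  Subfield.closure (P.exp '' S)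

/-- The sub-powered-field `S` of `P` is full: exp maps `S` onto the nonzero elements of its
field, and its field is (relatively) algebraically closed. -/
def PPF.FullSub (P : PPF K) (S : Submodule ℚ P.V) : Prop :=
  S ≤ P.D ∧ (∀ y ∈ P.fieldOf S, y ≠ 0 → ∃ x ∈ S, P.exp x = y) ∧
    ∀ y : P.F, (∃ p : Polynomial P.F, p ≠ 0 ∧ (∀ i, p.coeff i ∈ P.fieldOf S) ∧
      Polynomial.eval y p = 0) → y ∈ P.fieldOf S

/-- `(eV, eF)` is an isomorphism, over the base `D₀`, between the sub-partial-K-powered fields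
of `P` generated by `D₂` and `D₃`: `eV` is a `K`-linear bijection of the vector-space parts
mapping `D₂` onto `D₃` and fixing `D₀`, `eF` is a field isomorphism of the field parts fixing
the field of `D₀`, and the pair commutes with exp. -/
def PPF.IsIsoOver (P : PPF K) (D₂ D₃ D₀ : Submodule ℚ P.V)
    (eV : P.V → P.V) (eF : P.F → P.F) : Prop :=
  Set.BijOn eV (span K (D₂ : Set P.V) : Set P.V) (span K (D₃ : Set P.V)) ∧
  Set.BijOn eV (D₂ : Set P.V) (D₃ : Set P.V) ∧
  (∀ x y : P.V, x ∈ span K (D₂ : Set P.V) → y ∈ span K (D₂ : Set P.V) →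
    eV (x + y) = eV x + eV y) ∧
  (∀ (c : K) (x : P.V), x ∈ span K (D₂ : Set P.V) → eV (c • x) = c • eV x) ∧
  (∀ x ∈ D₀, eV x = x) ∧
  Set.BijOn eF (P.fieldOf D₂ : Set P.F) (P.fieldOf D₃ : Set P.F) ∧
  (∀ x y : P.F, x ∈ P.fieldOf D₂ → y ∈ P.fieldOf D₂ → eF (x + y) = eF x + eF y) ∧
  (∀ x y : P.F, x ∈ P.fieldOf D₂ → y ∈ P.fieldOf D₂ → eF (x * y) = eF x * eF y) ∧
  (∀ x ∈ D₀, eF (P.exp x) = P.exp x) ∧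
  (∀ x ∈ D₂, eF (P.exp x) = P.exp (eV x))

section TD
variable {F : Type} [Field F] [CharZero F]

/-- Algebraic closure operator. -/
def acl (B : Set F) : Set F := {x | IsAlgebraic (Algebra.adjoin ℚ B) x}

theorem acl_eq (B : Set F) : acl B = (AlgebraicIndependent.matroid ℚ F).closure B := by
  rw [AlgebraicIndependent.matroid_closure_eq]; rfl

theorem subset_acl (B : Set F) : B ⊆ acl B := by
  rw [acl_eq]; exact Matroid.subset_closure _ _ (by simp)

theorem acl_le {A B : Set F} (h : A ⊆ acl B) : acl A ⊆ acl B := by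
  rw [acl_eq] at *; rw [acl_eq]; exact Matroid.closure_subset_closure_of_subset_closure h

theorem acl_mono {A B : Set F} (h : A ⊆ B) : acl A ⊆ acl B := acl_le (h.trans (subset_acl B))

theorem isAlgebraic_union (B C : Set F) (x : F) :
    x ∈ acl (B ∪ C) ↔ IsAlgebraic (Algebra.adjoin (Algebra.adjoin ℚ B) C) x := by
  unfold acl
  rw [Algebra.adjoin_union_eq_adjoin_adjoin]
  exact Iff.rfl

theorem closure_rel (B C : Set F) :
    (AlgebraicIndependent.matroid (Algebra.adjoin ℚ B) F).closure C = acl (B ∪ C) := by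
  ext x
  rw [isAlgebraic_union, AlgebraicIndependent.matroid_closure_eq]; rfl

theorem steinitz {B : Set F} {n : ℕ} {f : Fin n → F} {C : Set F} (hC : C.Finite)
    (hf : AlgebraicIndependent (Algebra.adjoin ℚ B) f) (h : range f ⊆ acl (B ∪ C)) :
    n ≤ C.ncard := by
  set M := AlgebraicIndependent.matroid (Algebra.adjoin ℚ B) F
  have h1 : M.Indep (range f) := hf.to_subtype_range
  have h2 := M.eRk_mono (h.trans (closure_rel B C).symm.subset)
  rw [h1.eRk_eq_encard, M.eRk_closure_eq] at h2
  have h3 := h2.trans (M.eRk_le_encard C)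
  rw [← Set.image_univ, hf.injective.injOn.encard_image, ← hC.cast_ncard_eq] at h3
  simpa using h3

theorem td_bdd {A B : Set F} (hA : A.Finite) :
    BddAbove {n : ℕ | ∃ s : Fin n → F, (∀ i, s i ∈ A) ∧
    AlgebraicIndependent (Algebra.adjoin ℚ B) s} := by
  refine ⟨A.ncard, ?_⟩
  rintro n ⟨s, hs, hi⟩
  refine steinitz hA hi ?_
  rintro _ ⟨i, rfl⟩
  exact subset_acl _ (Or.inr (hs i))

theorem exists_td {A B : Set F} (hA : A.Finite) :
    ∃ s : Fin (td A B) → F, (∀ i, s i ∈ A) ∧ AlgebraicIndependent (Algebra.adjoin ℚ B) s :=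
  Nat.sSup_mem (s := {n : ℕ | ∃ s : Fin n → F, (∀ i, s i ∈ A) ∧
    AlgebraicIndependent (Algebra.adjoin ℚ B) s})
    ⟨0, Fin.elim0, fun i => i.elim0, by
      rw [algebraicIndependent_empty_type_iff]; exact FaithfulSMul.algebraMap_injective _ _⟩
    (td_bdd hA)

theorem td_ge {A B : Set F} (hA : A.Finite) {n : ℕ} (s : Fin n → F) (h : ∀ i, s i ∈ A)
    (hi : AlgebraicIndependent (Algebra.adjoin ℚ B) s) : n ≤ td A B :=
  le_csSup (td_bdd hA) ⟨s, h, hi⟩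

theorem exists_basis {A B : Set F} (hA : A.Finite) :
    ∃ C ⊆ A, C.Finite ∧ C.ncard ≤ td A B ∧ A ⊆ acl (B ∪ C) := by
  set M := AlgebraicIndependent.matroid (Algebra.adjoin ℚ B) F
  obtain ⟨C, hC⟩ := M.exists_isBasis A (by simp [M])
  have hCf : C.Finite := hA.subset hC.subset
  refine ⟨C, hC.subset, hCf, ?_, ?_⟩
  · have h1 : AlgebraicIndependent (Algebra.adjoin ℚ B) (Subtype.val : C → F) := hC.indep
    have := hCf.fintype
    let e : Fin (Fintype.card C) ≃ C := (Fintype.equivFin C).symm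
    have h2 := (algebraicIndependent_equiv e).2 h1
    have := td_ge hA _ (fun i => hC.subset (e i).2) h2
    rwa [← Nat.card_eq_fintype_card] at this
  · rw [← closure_rel]; exact hC.subset_closure

theorem le_td {A B : Set F} (hA : A.Finite) {ι : Type} [Fintype ι] {f : ι → F}
    (hf : AlgebraicIndependent (Algebra.adjoin ℚ B) f) (h : range f ⊆ acl (B ∪ A)) :
    Fintype.card ι ≤ td A B := by
  obtain ⟨C, hCA, hCf, hc, hA'⟩ := exists_basis (B := B) hA
  refine le_trans ?_ hc
  let e : Fin (Fintype.card ι) ≃ ι := (Fintype.equivFin ι).symm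
  refine steinitz hCf ((algebraicIndependent_equiv e).2 hf) ?_
  rw [e.surjective.range_comp]
  exact h.trans (acl_le (union_subset (subset_union_left.trans (subset_acl _)) hA'))

theorem td_le {A B C : Set F} (hA : A.Finite) (hC : C.Finite) (h : A ⊆ acl (B ∪ C)) :
    td A B ≤ C.ncard := by
  obtain ⟨s, hs, hi⟩ := exists_td (B := B) hA
  exact steinitz hC hi ((range_subset_iff.2 hs).trans h)

theorem td_super {A A' B S : Set F} (hA : A.Finite) (hA' : A'.Finite) (hBS : B ⊆ S)
    (hAS : A' ⊆ S) (h : A' ⊆ acl (B ∪ A)) : td A S + td A' B ≤ td A B := by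
  obtain ⟨s, hs, hsi⟩ := exists_td (B := S) hA
  obtain ⟨t, ht, hti⟩ := exists_td (B := B) hA'
  let i := Subalgebra.inclusion (Algebra.adjoin_mono (R := ℚ) hBS)
  let _ : Algebra (Algebra.adjoin ℚ B) (Algebra.adjoin ℚ S) := i.toRingHom.toAlgebra
  have : IsScalarTower (Algebra.adjoin ℚ B) (Algebra.adjoin ℚ S) F :=
    IsScalarTower.of_algebraMap_eq (fun x => rfl)
  have h3 := hti.sumElim_of_tower (S := Algebra.adjoin ℚ S) (by
    rintro _ ⟨j, rfl⟩
    exact ⟨⟨t j, Algebra.subset_adjoin (hAS (ht j))⟩, rfl⟩) hsi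
  have := le_td hA h3 (by
    rintro _ ⟨j | j, rfl⟩
    · exact subset_acl _ (Or.inr (hs j))
    · exact h (ht j))
  simpa using this

theorem td_sub {A A' B S : Set F} (hA : A.Finite) (hA' : A'.Finite)
    (hS : S ⊆ acl (B ∪ A')) : td (A ∪ A') B ≤ td A S + td A' B := by
  obtain ⟨C, hC, hCf, hc, hC'⟩ := exists_basis (B := S) hA
  obtain ⟨E, hE, hEf, he, hE'⟩ := exists_basis (B := B) hA'
  have h1 : A' ⊆ acl (B ∪ (C ∪ E)) :=
    hE'.trans (acl_mono (union_subset_union_right _ subset_union_right))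
  have h0 : B ⊆ acl (B ∪ (C ∪ E)) := subset_union_left.trans (subset_acl _)
  have h2 : S ⊆ acl (B ∪ (C ∪ E)) := hS.trans (acl_le (union_subset h0 h1))
  have h3 : A ⊆ acl (B ∪ (C ∪ E)) := hC'.trans (acl_le (union_subset h2
    ((subset_union_left.trans subset_union_right).trans (subset_acl _))))
  have := td_le (hA.union hA') (hCf.union hEf) (union_subset h3 h1)
  have := Set.ncard_union_le C E
  omega
end TD
section LD
variable {R V : Type} [Field R] [AddCommGroup V] [Module R V]

theorem ldim_eq (A B : Set V) :
    ldim R A B = Module.finrank R ((span R A).map (span R B).mkQ) := by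
  unfold ldim
  let f := (span R B).mkQ ∘ₗ (span R (A ∪ B)).subtype
  have hk : f.ker = (span R B).comap (span R (A ∪ B)).subtype := by
    simp [f, LinearMap.ker_comp]
  have hr : f.range = (span R A).map (span R B).mkQ := by
    simp [f, LinearMap.range_comp, span_union, Submodule.map_sup]
  rw [← hk, ← hr]
  exact f.quotKerEquivRange.finrank_eq

theorem finrank_map_add {W W' : Type} [AddCommGroup W] [Module R W] [AddCommGroup W'] [Module R W']
    (X : Submodule R W) [FiniteDimensional R X] (φ : W →ₗ[R] W') :
    Module.finrank R (X.map φ) + Module.finrank R (φ.ker ⊓ X : Submodule R W) =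
      Module.finrank R X := by
  have := LinearMap.finrank_range_add_finrank_ker (φ ∘ₗ X.subtype)
  rw [LinearMap.range_comp, Submodule.range_subtype, LinearMap.ker_comp] at this
  rw [← this, ← Submodule.finrank_map_subtype_eq X (comap X.subtype φ.ker),
    Submodule.map_comap_subtype, inf_comm]

theorem ldim_main {A B S : Set V} (hA : A.Finite) (hBS : span R B ≤ span R S) :
    ldim R A S + Module.finrank R ((span R S).map (span R B).mkQ ⊓
      (span R A).map (span R B).mkQ : Submodule R (V ⧸ span R B)) = ldim R A B := by
  have := FiniteDimensional.span_of_finite R hA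
  rw [ldim_eq, ldim_eq, ← finrank_map_add ((span R A).map (span R B).mkQ) (Submodule.factor hBS)]
  congr 1
  · rw [← Submodule.map_comp]; rfl
  · rw [Submodule.factor, Submodule.ker_mapQ]; rfl

theorem ldim_super {A A' B S : Set V} (hA : A.Finite) (hBS : span R B ≤ span R S)
    (hAS : A' ⊆ span R S) (h : A' ⊆ span R (A ∪ B)) : ldim R A S + ldim R A' B ≤ ldim R A B := by
  have := FiniteDimensional.span_of_finite R hA
  rw [← ldim_main hA hBS, ldim_eq A']
  gcongr
  apply Submodule.finrank_mono
  refine le_inf (Submodule.map_mono (span_le.2 hAS)) ?_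
  refine (Submodule.map_mono (span_le.2 h)).trans ?_
  simp [span_union, Submodule.map_sup]

theorem ldim_sub {A A' B S : Set V} (hA : A.Finite) (hA' : A'.Finite) (hBS : span R B ≤ span R S)
    (h : span R S ⊓ span R (A ∪ B) ≤ span R (A' ∪ B)) :
    ldim R A B ≤ ldim R A S + ldim R A' B := by
  have := FiniteDimensional.span_of_finite R hA'
  rw [← ldim_main hA hBS, ldim_eq A']
  gcongr
  apply Submodule.finrank_mono
  rintro _ ⟨⟨x, hx, rfl⟩, ⟨y, hy, hxy⟩⟩
  have h1 : x ∈ span R (A ∪ B) := by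
    have h2 : y - x ∈ span R B := by
      simpa using (Submodule.Quotient.eq _).1 hxy
    have h3 := sub_mem (span_mono (subset_union_left (t := B)) hy)
      (span_mono (subset_union_right (s := A)) h2)
    simpa using h3
  have h4 := Submodule.mem_map_of_mem (f := (span R B).mkQ) (h ⟨hx, h1⟩)
  simpa [span_union, Submodule.map_sup] using h4

theorem ldim_union_le {A A' B S : Set V} (hA : A.Finite) (hA' : A'.Finite)
    (hBS : span R B ≤ span R S) (h : span R S = span R (A' ∪ B)) :
    ldim R (A ∪ A') B ≤ ldim R A S + ldim R A' B := by
  refine (ldim_sub (hA.union hA') hA' hBS (inf_le_left.trans h.le)).trans ?_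
  gcongr
  refine le_of_eq ?_
  rw [ldim_eq, ldim_eq, span_union, Submodule.map_sup, sup_eq_left.2]
  refine le_trans ?_ bot_le
  rw [Submodule.map_le_iff_le_comap]
  simp [h, span_union]

theorem ldim_singleton_le (x : V) (B : Set V) : ldim R {x} B ≤ 1 := by
  rw [ldim_eq, Submodule.map_span, Set.image_singleton]
  exact finrank_span_le_card ({_} : Set _)

theorem ldim_singleton_eq {x : V} {B : Set V} (h : x ∉ span R B) : ldim R {x} B = 1 := by
  rw [ldim_eq, Submodule.map_span, Set.image_singleton]
  exact finrank_span_singleton (by simpa using h)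

theorem ldim_singleton_zero {x : V} {B : Set V} (h : x ∈ span R B) : ldim R {x} B = 0 := by
  rw [ldim_eq, Submodule.map_span, Set.image_singleton]
  have : (span R B).mkQ x = 0 := by simpa using h
  rw [this]; simp
end LD
section PP

instance PPF.tower (P : PPF K) : IsScalarTower ℚ K P.V := IsScalarTower.rat

theorem PPF.exp_zero (P : PPF K) : P.exp 0 = 1 := by
  have h := P.exp_add 0 (zero_mem _) 0 (zero_mem _)
  rw [add_zero] at h
  exact (mul_eq_left₀ (P.exp_ne_zero 0 (zero_mem _))).1 h.symm

theorem PPF.exp_nsmul (P : PPF K) {x : P.V} (hx : x ∈ P.D) (n : ℕ) :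
    P.exp (n • x) = P.exp x ^ n := by
  induction n with
  | zero => simp [P.exp_zero]
  | succ k ih => rw [succ_nsmul, P.exp_add _ (nsmul_mem hx k) _ hx, ih, pow_succ]

theorem PPF.exp_neg (P : PPF K) {x : P.V} (hx : x ∈ P.D) : P.exp (-x) = (P.exp x)⁻¹ := by
  have h := P.exp_add x hx (-x) (neg_mem hx)
  rw [add_neg_cancel, P.exp_zero] at h
  exact eq_inv_of_mul_eq_one_right h.symm

theorem PPF.exp_zsmul (P : PPF K) {x : P.V} (hx : x ∈ P.D) (n : ℤ) :
    P.exp (n • x) = P.exp x ^ n := by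
  obtain ⟨k, rfl | rfl⟩ := n.eq_nat_or_neg
  · simp [P.exp_nsmul hx]
  · rw [neg_smul, P.exp_neg (zsmul_mem hx _)]
    simp [P.exp_nsmul hx]

theorem PPF.exp_span_acl (P : PPF K) {X : Set P.V} (hX : X ⊆ P.D) {x : P.V} (hx : x ∈ span ℚ X) :
    P.exp x ∈ acl (P.exp '' X) := by
  have hle : span ℚ X ≤ P.D := span_le.2 hX
  induction hx using Submodule.span_induction with
  | mem x hx => exact subset_acl _ ⟨x, hx, rfl⟩
  | zero => rw [P.exp_zero]; exact isAlgebraic_one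
  | add x y hx hy ihx ihy =>
    rw [P.exp_add _ (hle hx) _ (hle hy)]; exact IsAlgebraic.mul ihx ihy
  | smul q x hx ih =>
    have h1 : P.exp (q • x) ^ q.den = P.exp x ^ q.num := by
      rw [← P.exp_nsmul (P.D.smul_mem q (hle hx)), ← P.exp_zsmul (hle hx)]
      congr 1
      rw [← Nat.cast_smul_eq_nsmul ℚ, ← Int.cast_smul_eq_zsmul ℚ, smul_smul, mul_comm,
        Rat.mul_den_eq_num]
    refine IsAlgebraic.of_pow q.den_pos ?_
    rw [h1]
    have ih' : IsAlgebraic (Algebra.adjoin ℚ (P.exp '' X)) (P.exp x) := ih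
    obtain ⟨k, h | h⟩ := q.num.eq_nat_or_neg
    · rw [h, zpow_natCast]; exact ih'.pow k
    · rw [h, zpow_neg, zpow_natCast]; exact (ih'.pow k).inv

theorem PPF.delta_pos (P : PPF K) (D₀ : Submodule ℚ P.V) (hstrong : P.StrongExt D₀ P.D)
    (v : P.V) (hvgen : v ∉ P.pclIn P.D (D₀ : Set P.V)) (n : ℕ) (w : Fin n → P.V)
    (hw : ∀ i, w i ∈ P.D) (hvw : v ∈ range w) : 1 ≤ P.delta (range w) (D₀ : Set P.V) := by
  by_contra hcon
  obtain ⟨h0, -, -, hδ⟩ := hstrong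
  apply hvgen
  unfold PPF.pclIn
  rw [Submodule.mem_sInf]
  rintro S ⟨hDS, hSD, hS⟩
  obtain ⟨i, rfl⟩ := hvw
  refine hS n w hw ?_ i
  have hwf := Set.finite_range w
  have hfd := FiniteDimensional.span_of_finite ℚ hwf
  have hfd2 : FiniteDimensional ℚ (span ℚ (range w) ⊓ S : Submodule ℚ P.V) :=
    Submodule.finiteDimensional_inf_left _ _
  obtain ⟨m, u, hu⟩ := Submodule.fg_iff_exists_fin_generating_family.1
    ((Submodule.fg_top _).1 hfd2.fg_top)
  have huf := Set.finite_range u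
  have huw : range u ⊆ span ℚ (range w) := fun x hx =>
    (hu ▸ subset_span hx : x ∈ span ℚ (range w) ⊓ S).1
  have huS : range u ⊆ S := fun x hx =>
    (hu ▸ subset_span hx : x ∈ span ℚ (range w) ⊓ S).2
  have h1 := hδ m u (fun i => hSD (huS ⟨i, rfl⟩))
  have hwD : range w ⊆ P.D := range_subset_iff.2 hw
  have a1 := ldim_super (R := K) (A := range w) (A' := range u) (B := (D₀ : Set P.V))
    (S := (S : Set P.V)) hwf (span_mono hDS) (huS.trans subset_span)
    (huw.trans ((span_subset_span ℚ K _).trans (span_mono subset_union_left)))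
  have a2 := td_super (A := P.exp '' range w) (A' := P.exp '' range u)
    (B := P.exp '' (D₀ : Set P.V)) (S := P.exp '' (S : Set P.V)) (hwf.image _) (huf.image _)
    (image_mono hDS) (image_mono huS) (by
      rintro _ ⟨x, hx, rfl⟩
      exact acl_mono subset_union_right (P.exp_span_acl hwD (huw hx)))
  have a3 := ldim_sub (R := ℚ) (A := range w) (A' := range u) (B := (D₀ : Set P.V))
    (S := (S : Set P.V)) hwf huf (span_mono hDS) (by
      rw [span_union, span_union, hu, span_eq, span_eq, inf_comm, sup_comm,
        sup_inf_assoc_of_le _ (SetLike.coe_subset_coe.1 hDS), sup_comm])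
  unfold PPF.delta at *
  omega

theorem PPF.strong_adjoin (P : PPF K) (D₀ : Submodule ℚ P.V) (hstrong : P.StrongExt D₀ P.D)
    (v : P.V) (hv : v ∈ P.D) (hvgen : v ∉ P.pclIn P.D (D₀ : Set P.V)) :
    P.StrongExt (D₀ ⊔ span ℚ {v}) P.D := by
  have hs := hstrong
  obtain ⟨h0, -, hker, hδ⟩ := hstrong
  have hle : D₀ ⊔ span ℚ {v} ≤ P.D := sup_le h0 (span_le.2 (by simpa using hv))
  have hvD : v ∉ D₀ := by
    intro h
    apply hvgen
    unfold PPF.pclIn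
    rw [Submodule.mem_sInf]
    rintro S ⟨hDS, -⟩
    exact hDS h
  refine ⟨hle, le_rfl, fun x hx h => le_sup_left (a := D₀) (hker x hx h), fun n z hz => ?_⟩
  have hp := P.delta_pos D₀ hs v hvgen (n + 1) (Fin.cons v z)
    (fun i => by refine Fin.cases ?_ ?_ i <;> simp [hv, hz]) ⟨0, rfl⟩
  rw [Fin.range_cons, Set.insert_eq, Set.union_comm] at hp
  have hzf := Set.finite_range z
  have hQ : span ℚ ((D₀ ⊔ span ℚ {v} : Submodule ℚ P.V) : Set P.V) = span ℚ ({v} ∪ D₀) := by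
    rw [span_union, span_eq, span_eq, sup_comm]
  have hDle : (D₀ : Set P.V) ⊆ (D₀ ⊔ span ℚ {v} : Submodule ℚ P.V) :=
    fun x hx => le_sup_left (a := D₀) hx
  have hvin : v ∈ D₀ ⊔ span ℚ {v} := le_sup_right (a := D₀) (mem_span_singleton_self v)
  have hK : span K ((D₀ ⊔ span ℚ {v} : Submodule ℚ P.V) : Set P.V) = span K ({v} ∪ D₀) := by
    apply le_antisymm
    · rw [span_le]
      intro x hx
      apply span_subset_span ℚ K
      rw [← hQ]; exact subset_span hx
    · exact span_mono (union_subset (by simpa using hvin) hDle)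
  have a1 := ldim_union_le (R := K) (A := range z) (A' := {v}) (B := (D₀ : Set P.V))
    (S := ((D₀ ⊔ span ℚ {v} : Submodule ℚ P.V) : Set P.V)) hzf (finite_singleton v)
    (span_mono hDle) hK
  have a2 := td_sub (A := P.exp '' range z) (A' := P.exp '' {v})
    (B := P.exp '' (D₀ : Set P.V)) (S := P.exp '' ((D₀ ⊔ span ℚ {v} : Submodule ℚ P.V) : Set P.V))
    (hzf.image _) ((finite_singleton v).image _) (by
      rintro _ ⟨x, hx, rfl⟩
      rw [← image_union]
      refine P.exp_span_acl (union_subset h0 (by simpa using hv)) ?_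
      rw [union_comm, ← hQ]; exact subset_span hx)
  have a3 := ldim_super (R := ℚ) (A := range z ∪ {v}) (A' := {v}) (B := (D₀ : Set P.V))
    (S := ((D₀ ⊔ span ℚ {v} : Submodule ℚ P.V) : Set P.V)) (hzf.union (finite_singleton v))
    (span_mono hDle) (by simpa using hvin)
    (subset_span.trans (span_mono (subset_union_right.trans subset_union_left)))
  have a4 : ldim ℚ (range z) (D₀ ⊔ span ℚ {v} : Submodule ℚ P.V) ≤
      ldim ℚ (range z ∪ {v}) (D₀ ⊔ span ℚ {v} : Submodule ℚ P.V) := by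
    have := FiniteDimensional.span_of_finite ℚ (hzf.union (finite_singleton v))
    rw [ldim_eq, ldim_eq]
    exact Submodule.finrank_mono (Submodule.map_mono (span_mono subset_union_left))
  have b1 := ldim_singleton_le (R := K) v (D₀ : Set P.V)
  have b2 : td (P.exp '' {v}) (P.exp '' (D₀ : Set P.V)) ≤ 1 := by
    have := td_le (A := P.exp '' {v}) (B := P.exp '' (D₀ : Set P.V)) (C := P.exp '' {v})
      ((finite_singleton v).image _) ((finite_singleton v).image _)
      (subset_union_right.trans (subset_acl _))
    simpa using this
  have b3 := ldim_singleton_eq (R := ℚ) (x := v) (B := (D₀ : Set P.V)) (by simpa using hvD)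
  unfold PPF.delta at *
  rw [image_union] at hp
  omega

theorem PPF.generic (P : PPF K) (D₀ : Submodule ℚ P.V) (hstrong : P.StrongExt D₀ P.D)
    (v : P.V) (hv : v ∈ P.D) (hvgen : v ∉ P.pclIn P.D (D₀ : Set P.V)) :
    v ∉ span K (D₀ : Set P.V) ∧
      Transcendental (Algebra.adjoin ℚ (P.exp '' (D₀ : Set P.V))) (P.exp v) := by
  have hvD : v ∉ D₀ := by
    intro h
    apply hvgen
    unfold PPF.pclIn
    rw [Submodule.mem_sInf]
    rintro S ⟨hDS, -⟩
    exact hDS h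
  have hp := P.delta_pos D₀ hstrong v hvgen 1 (fun _ => v) (fun _ => hv) ⟨0, rfl⟩
  rw [Set.range_const] at hp
  have b1 := ldim_singleton_le (R := K) v (D₀ : Set P.V)
  have b2 : td (P.exp '' {v}) (P.exp '' (D₀ : Set P.V)) ≤ 1 := by
    have := td_le (A := P.exp '' {v}) (B := P.exp '' (D₀ : Set P.V)) (C := P.exp '' {v})
      ((finite_singleton v).image _) ((finite_singleton v).image _)
      (subset_union_right.trans (subset_acl _))
    simpa using this
  have b3 := ldim_singleton_eq (R := ℚ) (x := v) (B := (D₀ : Set P.V)) (by simpa using hvD)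
  unfold PPF.delta at hp
  constructor
  · intro h
    have := ldim_singleton_zero h
    omega
  · intro h
    have := td_le (A := P.exp '' {v}) (B := P.exp '' (D₀ : Set P.V)) (C := ∅)
      ((finite_singleton v).image _) finite_empty (by
        rw [union_empty, image_singleton, singleton_subset_iff]; exact h)
    rw [ncard_empty] at this
    omega
end PP
section Iso

theorem PPF.exp_indep (P : PPF K) {R : Subalgebra ℚ P.F} {w : P.V} (hw : w ∈ P.D)
    (ht : Transcendental R (P.exp w)) (s : Finset ℚ) (c : ℚ → R)
    (h : ∑ q ∈ s, c q • P.exp (q • w) = 0) : ∀ q ∈ s, c q = 0 := by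
  obtain ⟨b, hb⟩ := IsLocalization.exist_integer_multiples_of_finset (nonZeroDivisors ℤ) s
  have hb0 : (b : ℤ) ≠ 0 := nonZeroDivisors.coe_ne_zero b
  have hb0' : ((b : ℤ) : ℚ) ≠ 0 := by exact_mod_cast hb0
  have hb' : ∀ q : ℚ, ∃ n : ℤ, q ∈ s → (n : ℚ) = (b : ℤ) * q := by
    intro q
    by_cases hq : q ∈ s
    · obtain ⟨n, hn⟩ := hb q hq
      exact ⟨n, fun _ => by simpa using hn⟩
    · exact ⟨0, fun h => absurd h hq⟩
  choose n hn using hb'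
  set w₁ : P.V := ((b : ℤ) : ℚ)⁻¹ • w with hw₁
  have hw₁D : w₁ ∈ P.D := P.D.smul_mem _ hw
  set t := P.exp w₁ with htdef
  have ht0 : t ≠ 0 := P.exp_ne_zero _ hw₁D
  have htr : Transcendental R t := by
    intro hal
    apply ht
    have : P.exp w = t ^ (b : ℤ) := by
      rw [htdef, ← P.exp_zsmul hw₁D, hw₁, ← Int.cast_smul_eq_zsmul ℚ, smul_smul,
        mul_inv_cancel₀ hb0', one_smul]
    rw [this]
    obtain ⟨k, h | h⟩ := (b : ℤ).eq_nat_or_neg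
    · rw [h, zpow_natCast]; exact hal.pow k
    · rw [h, zpow_neg, zpow_natCast]; exact (hal.pow k).inv
  set M : ℕ := ∑ q ∈ s, (n q).natAbs with hM
  have hMle : ∀ q ∈ s, (n q).natAbs ≤ M := fun q hq =>
    Finset.single_le_sum (f := fun q => (n q).natAbs) (fun _ _ => Nat.zero_le _) hq
  set e : ℚ → ℕ := fun q => (n q + M).toNat with he
  have hecast : ∀ q ∈ s, (e q : ℤ) = n q + M := by
    intro q hq
    have := hMle q hq
    simp only [he]
    omega
  have hexp : ∀ q ∈ s, t ^ e q = P.exp (q • w) * t ^ M := by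
    intro q hq
    rw [← zpow_natCast, hecast q hq, zpow_add₀ ht0, zpow_natCast, htdef, ← P.exp_zsmul hw₁D, hw₁,
      ← Int.cast_smul_eq_zsmul ℚ, smul_smul, hn q hq]
    congr 3
    field_simp
  have hp := (transcendental_iff.1 htr) (∑ q ∈ s, Polynomial.monomial (e q) (c q)) (by
    rw [map_sum]
    calc ∑ q ∈ s, Polynomial.aeval t (Polynomial.monomial (e q) (c q))
        = ∑ q ∈ s, (c q • P.exp (q • w)) * t ^ M := by
          refine Finset.sum_congr rfl fun q hq => ?_
          rw [Polynomial.aeval_monomial, hexp q hq, Algebra.smul_def, mul_assoc]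
      _ = 0 := by rw [← Finset.sum_mul, h, zero_mul])
  intro q₀ hq₀
  have hc := congrArg (fun p => Polynomial.coeff p (e q₀)) hp
  simp only [Polynomial.finsetSum_coeff, Polynomial.coeff_monomial, Polynomial.coeff_zero] at hc
  rw [Finset.sum_eq_single q₀] at hc
  · simpa using hc
  · intro q hq hne
    rw [if_neg]
    intro hee
    apply hne
    have h1 := hecast q hq
    have h2 := hecast q₀ hq₀
    have h3 : n q = n q₀ := by omega
    have h4 := hn q hq
    rw [h3, hn q₀ hq₀] at h4
    exact (mul_left_cancel₀ hb0' h4).symm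
  · exact fun h => absurd hq₀ h

/-- The exponential along the line spanned by `w`. -/
def PPF.lineHom (P : PPF K) {w : P.V} (hw : w ∈ P.D) : Multiplicative ℚ →* P.F where
  toFun q := P.exp (q.toAdd • w)
  map_one' := by simp [P.exp_zero]
  map_mul' a b := by
    rw [toAdd_mul, add_smul, P.exp_add _ (P.D.smul_mem _ hw) _ (P.D.smul_mem _ hw)]

/-- The evaluation of the group algebra. -/
noncomputable def PPF.evalHom (P : PPF K) (R : Subalgebra ℚ P.F) {w : P.V} (hw : w ∈ P.D) :
    AddMonoidAlgebra R ℚ →ₐ[R] P.F :=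
  AddMonoidAlgebra.lift R P.F ℚ (P.lineHom hw)

theorem PPF.evalHom_single (P : PPF K) (R : Subalgebra ℚ P.F) {w : P.V} (hw : w ∈ P.D)
    (q : ℚ) (r : R) : P.evalHom R hw (AddMonoidAlgebra.single q r) = r * P.exp (q • w) := by
  unfold PPF.evalHom
  rw [AddMonoidAlgebra.lift_single]; rfl

theorem PPF.evalHom_inj (P : PPF K) {R : Subalgebra ℚ P.F} {w : P.V} (hw : w ∈ P.D)
    (ht : Transcendental R (P.exp w)) : Function.Injective (P.evalHom R hw) := by
  rw [injective_iff_map_eq_zero]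
  intro a ha
  unfold PPF.evalHom at ha
  rw [AddMonoidAlgebra.lift_apply] at ha
  have := P.exp_indep hw ht a.coeff.support a.coeff ha
  ext q
  by_cases hq : q ∈ a.coeff.support
  · simp [this q hq]
  · simpa using hq

theorem PPF.mem_adjoin (P : PPF K) {D₀ : Submodule ℚ P.V} {w x : P.V} :
    x ∈ D₀ ⊔ span ℚ {w} ↔ ∃ d ∈ D₀, ∃ q : ℚ, x = d + q • w := by
  rw [Submodule.mem_sup]
  constructor
  · rintro ⟨d, hd, y, hy, rfl⟩
    obtain ⟨q, rfl⟩ := mem_span_singleton.1 hy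
    exact ⟨d, hd, q, rfl⟩
  · rintro ⟨d, hd, q, rfl⟩
    exact ⟨d, hd, _, mem_span_singleton.2 ⟨q, rfl⟩, rfl⟩

theorem PPF.mem_spanK (P : PPF K) {D₀ : Submodule ℚ P.V} {w x : P.V} :
    x ∈ span K ((D₀ ⊔ span ℚ {w} : Submodule ℚ P.V) : Set P.V) ↔
      ∃ d ∈ span K (D₀ : Set P.V), ∃ c : K, x = d + c • w := by
  have hK : span K ((D₀ ⊔ span ℚ {w} : Submodule ℚ P.V) : Set P.V) =
      span K (D₀ : Set P.V) ⊔ span K {w} := by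
    rw [← span_union]
    apply le_antisymm
    · rw [span_le]
      intro x hx
      apply span_subset_span ℚ K
      rw [span_union, span_eq]; exact hx
    · refine span_mono (union_subset (fun x hx => le_sup_left (a := D₀) hx) ?_)
      rw [singleton_subset_iff]
      exact le_sup_right (a := D₀) (mem_span_singleton_self w)
  rw [hK, Submodule.mem_sup]
  constructor
  · rintro ⟨d, hd, y, hy, rfl⟩
    obtain ⟨q, rfl⟩ := mem_span_singleton.1 hy
    exact ⟨d, hd, q, rfl⟩
  · rintro ⟨d, hd, q, rfl⟩
    exact ⟨d, hd, _, mem_span_singleton.2 ⟨q, rfl⟩, rfl⟩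

theorem PPF.fieldOf_eq (P : PPF K) {D₀ : Submodule ℚ P.V} (h0 : D₀ ≤ P.D) {w : P.V}
    (hw : w ∈ P.D) :
    Subfield.closure
      ((P.evalHom (Algebra.adjoin ℚ (P.exp '' (D₀ : Set P.V))) hw).toRingHom.range : Set P.F) =
      P.fieldOf (D₀ ⊔ span ℚ {w}) := by
  apply le_antisymm
  · rw [Subfield.closure_le]
    rintro _ ⟨a, rfl⟩
    have hR : ∀ r : Algebra.adjoin ℚ (P.exp '' (D₀ : Set P.V)),
        (r : P.F) ∈ P.fieldOf (D₀ ⊔ span ℚ {w}) := by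
      rintro ⟨r, hr⟩
      show r ∈ _
      induction hr using Algebra.adjoin_induction with
      | mem x hx =>
        obtain ⟨d, hd, rfl⟩ := hx
        exact Subfield.subset_closure ⟨d, le_sup_left (a := D₀) hd, rfl⟩
      | algebraMap q => exact SubfieldClass.ratCast_mem _ q
      | add x y _ _ hx hy => exact add_mem hx hy
      | mul x y _ _ hx hy => exact mul_mem hx hy
    show P.evalHom _ hw a ∈ _
    unfold PPF.evalHom
    rw [AddMonoidAlgebra.lift_apply]
    refine sum_mem fun q _ => ?_
    show (a.coeff q : P.F) * P.exp (q • w) ∈ _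
    refine mul_mem (hR _) (Subfield.subset_closure ⟨q • w, ?_, rfl⟩)
    exact P.mem_adjoin.2 ⟨0, zero_mem _, q, by simp⟩
  · refine Subfield.closure_mono ?_
    rintro _ ⟨x, hx, rfl⟩
    obtain ⟨d, hd, q, rfl⟩ := P.mem_adjoin.1 hx
    refine ⟨AddMonoidAlgebra.single q ⟨P.exp d, Algebra.subset_adjoin ⟨d, hd, rfl⟩⟩, ?_⟩
    show P.evalHom _ hw _ = _
    rw [P.evalHom_single, P.exp_add _ (h0 hd) _ (P.D.smul_mem _ hw)]

theorem PPF.exists_iso (P : PPF K) (D₀ : Submodule ℚ P.V) (h0 : D₀ ≤ P.D) (v v' : P.V)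
    (hv : v ∈ P.D) (hv' : v' ∈ P.D)
    (hvs : v ∉ span K (D₀ : Set P.V)) (hvs' : v' ∉ span K (D₀ : Set P.V))
    (ht : Transcendental (Algebra.adjoin ℚ (P.exp '' (D₀ : Set P.V))) (P.exp v))
    (ht' : Transcendental (Algebra.adjoin ℚ (P.exp '' (D₀ : Set P.V))) (P.exp v')) :
    ∃ (eV : P.V → P.V) (eF : P.F → P.F),
      P.IsIsoOver (D₀ ⊔ span ℚ {v}) (D₀ ⊔ span ℚ {v'}) D₀ eV eF ∧ eV v = v' := by
  have key : ∀ (a a' : P.V), a ∉ span K (D₀ : Set P.V) → ∃ e : P.V →ₗ[K] P.V,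
      ∀ d ∈ span K (D₀ : Set P.V), ∀ c : K, e (d + c • a) = d + c • a' := by
    intro a a' ha
    obtain ⟨f, hf, hker⟩ := Submodule.exists_le_ker_of_notMem ha
    refine ⟨LinearMap.id + f.smulRight ((f a)⁻¹ • (a' - a)), fun d hd c => ?_⟩
    have hfd : f d = 0 := hker hd
    simp only [LinearMap.add_apply, LinearMap.id_apply, LinearMap.smulRight_apply, map_add,
      map_smul, hfd, smul_smul]
    rw [mul_inv_cancel₀ hf, zero_mul, zero_smul, one_smul, add_zero, add_sub_cancel]
  obtain ⟨e, he⟩ := key v v' hvs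
  obtain ⟨g, hg⟩ := key v' v hvs'
  have ratsmul : ∀ (q : ℚ) (x : P.V), q • x = (q : K) • x := fun q x =>
    (Rat.cast_smul_eq_qsmul K q x).symm
  have heq : ∀ d ∈ D₀, ∀ q : ℚ, e (d + q • v) = d + q • v' := by
    intro d hd q
    rw [ratsmul, ratsmul]; exact he d (subset_span hd) _
  have hgq : ∀ d ∈ D₀, ∀ q : ℚ, g (d + q • v') = d + q • v := by
    intro d hd q
    rw [ratsmul, ratsmul]; exact hg d (subset_span hd) _
  set R := Algebra.adjoin ℚ (P.exp '' (D₀ : Set P.V)) with hR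
  have inj := P.evalHom_inj hv ht
  have inj' := P.evalHom_inj hv' ht'
  have hdom : IsDomain (AddMonoidAlgebra R ℚ) := Function.Injective.isDomain _ inj
  let ψ : FractionRing (AddMonoidAlgebra R ℚ) →+* P.F :=
    IsFractionRing.lift (g := (P.evalHom R hv).toRingHom) inj
  let ψ' : FractionRing (AddMonoidAlgebra R ℚ) →+* P.F :=
    IsFractionRing.lift (g := (P.evalHom R hv').toRingHom) inj'
  have hψr : ψ.fieldRange = P.fieldOf (D₀ ⊔ span ℚ {v}) := by
    rw [← P.fieldOf_eq h0 hv]; exact IsFractionRing.lift_fieldRange _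
  have hψr' : ψ'.fieldRange = P.fieldOf (D₀ ⊔ span ℚ {v'}) := by
    rw [← P.fieldOf_eq h0 hv']; exact IsFractionRing.lift_fieldRange _
  have hsingle : ∀ d (hd : d ∈ D₀) (q : ℚ), ∃ y, ψ y = P.exp (d + q • v) ∧
      ψ' y = P.exp (d + q • v') := by
    intro d hd q
    refine ⟨algebraMap _ _ (AddMonoidAlgebra.single q
      (⟨P.exp d, Algebra.subset_adjoin ⟨d, hd, rfl⟩⟩ : R)), ?_, ?_⟩
    · rw [IsFractionRing.lift_algebraMap, P.exp_add _ (h0 hd) _ (P.D.smul_mem _ hv)]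
      exact P.evalHom_single R hv _ _
    · rw [IsFractionRing.lift_algebraMap, P.exp_add _ (h0 hd) _ (P.D.smul_mem _ hv')]
      exact P.evalHom_single R hv' _ _
  have hinv : ∀ y, Function.invFun ψ (ψ y) = y := Function.leftInverse_invFun ψ.injective
  have hmem : ∀ x, x ∈ P.fieldOf (D₀ ⊔ span ℚ {v}) ↔ ∃ y, ψ y = x := by
    intro x; rw [← hψr]; exact RingHom.mem_fieldRange
  have hmem' : ∀ x, x ∈ P.fieldOf (D₀ ⊔ span ℚ {v'}) ↔ ∃ y, ψ' y = x := by
    intro x; rw [← hψr']; exact RingHom.mem_fieldRange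
  have hexp : ∀ x ∈ D₀ ⊔ span ℚ {v}, ψ' (Function.invFun ψ (P.exp x)) = P.exp (e x) := by
    intro x hx
    obtain ⟨d, hd, q, rfl⟩ := P.mem_adjoin.1 hx
    obtain ⟨y, h1, h2⟩ := hsingle d hd q
    rw [← h1, hinv, h2, heq d hd q]
  have hfix : ∀ x ∈ D₀, e x = x := fun x hx => by simpa using heq x hx 0
  refine ⟨e, fun x => ψ' (Function.invFun ψ x), ⟨?_, ?_, ?_, ?_, hfix, ?_, ?_, ?_, ?_, hexp⟩, ?_⟩
  · refine InvOn.bijOn (f' := g) ⟨?_, ?_⟩ ?_ ?_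
    · intro x hx
      obtain ⟨d, hd, c, rfl⟩ := P.mem_spanK.1 hx
      rw [he d hd, hg d hd]
    · intro x hx
      obtain ⟨d, hd, c, rfl⟩ := P.mem_spanK.1 hx
      rw [hg d hd, he d hd]
    · intro x hx
      obtain ⟨d, hd, c, rfl⟩ := P.mem_spanK.1 hx
      rw [he d hd]; exact P.mem_spanK.2 ⟨d, hd, c, rfl⟩
    · intro x hx
      obtain ⟨d, hd, c, rfl⟩ := P.mem_spanK.1 hx
      rw [hg d hd]; exact P.mem_spanK.2 ⟨d, hd, c, rfl⟩
  · refine InvOn.bijOn (f' := g) ⟨?_, ?_⟩ ?_ ?_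
    · intro x hx
      obtain ⟨d, hd, c, rfl⟩ := P.mem_adjoin.1 hx
      rw [heq d hd, hgq d hd]
    · intro x hx
      obtain ⟨d, hd, c, rfl⟩ := P.mem_adjoin.1 hx
      rw [hgq d hd, heq d hd]
    · intro x hx
      obtain ⟨d, hd, c, rfl⟩ := P.mem_adjoin.1 hx
      rw [heq d hd]; exact P.mem_adjoin.2 ⟨d, hd, c, rfl⟩
    · intro x hx
      obtain ⟨d, hd, c, rfl⟩ := P.mem_adjoin.1 hx
      rw [hgq d hd]; exact P.mem_adjoin.2 ⟨d, hd, c, rfl⟩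
  · intro x y _ _; exact map_add e x y
  · intro c x _; exact map_smul e c x
  · refine ⟨?_, ?_, ?_⟩
    · intro x _
      exact (hmem' _).2 ⟨_, rfl⟩
    · intro x hx y hy hxy
      obtain ⟨a, rfl⟩ := (hmem _).1 hx
      obtain ⟨b, rfl⟩ := (hmem _).1 hy
      simp only [hinv] at hxy
      rw [ψ'.injective hxy]
    · intro x hx
      obtain ⟨a, rfl⟩ := (hmem' _).1 hx
      refine ⟨ψ a, (hmem _).2 ⟨a, rfl⟩, ?_⟩
      simp only [hinv]
  · intro x y hx hy
    obtain ⟨a, rfl⟩ := (hmem _).1 hx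
    obtain ⟨b, rfl⟩ := (hmem _).1 hy
    show ψ' (Function.invFun ψ (ψ a + ψ b)) = ψ' (Function.invFun ψ (ψ a)) +
      ψ' (Function.invFun ψ (ψ b))
    rw [← RingHom.map_add ψ, hinv, hinv, hinv, RingHom.map_add ψ']
  · intro x y hx hy
    obtain ⟨a, rfl⟩ := (hmem _).1 hx
    obtain ⟨b, rfl⟩ := (hmem _).1 hy
    show ψ' (Function.invFun ψ (ψ a * ψ b)) = ψ' (Function.invFun ψ (ψ a)) *
      ψ' (Function.invFun ψ (ψ b))
    rw [← RingHom.map_mul ψ, hinv, hinv, hinv, RingHom.map_mul ψ']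
  · intro x hx
    have := hexp x (le_sup_left (a := D₀) hx)
    rw [hfix x hx] at this
    exact this
  · simpa using heq 0 (zero_mem _) 1
end Iso

/-- **Uniqueness of the generic type** (Lemma 4.13): if D₀ ◁ D with D full and
v ∈ D \ pcl(D₀), then ⟨D₀, v⟩_ℚ ◁ D, and for any other v' ∈ D \ pcl(D₀) there is an
isomorphism ⟨D₀, v⟩_ℚ ≅ ⟨D₀, v'⟩_ℚ over D₀ sending v to v'. -/
theorem generic_type_unique (P : PPF K) (D₀ : Submodule ℚ P.V)
    (hfull : P.FullSub P.D) (hstrong : P.StrongExt D₀ P.D)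
    (v : P.V) (hv : v ∈ P.D) (hvgen : v ∉ P.pclIn P.D (D₀ : Set P.V)) :
    P.StrongExt (D₀ ⊔ span ℚ {v}) P.D ∧
    ∀ v' : P.V, v' ∈ P.D → v' ∉ P.pclIn P.D (D₀ : Set P.V) →
      ∃ (eV : P.V → P.V) (eF : P.F → P.F),
        P.IsIsoOver (D₀ ⊔ span ℚ {v}) (D₀ ⊔ span ℚ {v'}) D₀ eV eF ∧ eV v = v' := by
  refine ⟨P.strong_adjoin D₀ hstrong v hv hvgen, fun v' hv' hvgen' => ?_⟩
  obtain ⟨h1, h2⟩ := P.generic D₀ hstrong v hv hvgen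
  obtain ⟨h1', h2'⟩ := P.generic D₀ hstrong v' hv' hvgen'
  exact P.exists_iso D₀ hstrong.1 v v' hv hv' h1 h1' h2 h2'
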